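/- arXiv:2601.09541 — 3 statements merged into one kernel-verified Lean document; each statement's English description precedes it below -/
import Mathlib

section
/- Let S_f, S_g ⊆ ℝ × ℝ each be convex, contain (0,0), satisfy a ∈ [0,1] for every element (r,a), and have first coordinates bounded above. For X ∈ {f,g}, define R_X(q) = sup{r : ∃ a, (r,a) ∈ S_X ∧ a ≤ q} for q ∈ [0,1] and Π_X(λ) = sup{r − λ·a : (r,a) ∈ S_X} for λ ≥ 0. Suppose c ≥ 1 and Π_f(λ) ≤ c·Π_g(λ) for every λ ≥ 0. Then R_f(q) ≤ c·R_g(q) for every q ∈ (0,1); i.e., a c-approximation at the level of Lagrangian relaxations transfers to a c-approximation of the ex-ante constrained optimum at every interior allocation cap. -/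
open Set

/-- A convex planar set, lying weakly below `v` on the strip `{p | p.2 ≤ q}` and meeting the open
strip `{p | p.2 < q}`, has a supporting line of non-negative slope through `(v, q)`. -/
theorem exists_nonneg_supporting_slope {S : Set (ℝ × ℝ)} (hS : Convex ℝ S) {q v : ℝ}
    (hv : ∀ p ∈ S, p.2 ≤ q → p.1 ≤ v) (hq : ∃ p ∈ S, p.2 < q) :
    ∃ l : ℝ, 0 ≤ l ∧ ∀ p ∈ S, p.1 - l * p.2 ≤ v - l * q := by
  obtain ⟨p₀, hp₀, hp₀q⟩ := hq
  let right : Set ℝ := insert 0 ((fun p : ℝ × ℝ => (p.1 - v) / (p.2 - q)) '' {p ∈ S | q < p.2})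
  let left : Set ℝ := (fun p : ℝ × ℝ => (v - p.1) / (q - p.2)) '' {p ∈ S | p.2 < q}
  obtain ⟨l, hl_right, hl_left⟩ : (upperBounds right ∩ lowerBounds left).Nonempty := by
    refine exists_between_of_forall_le ⟨0, mem_insert _ _⟩ ⟨_, p₀, ⟨hp₀, hp₀q⟩, rfl⟩ ?_
    rintro x hx _ ⟨p, ⟨hp, hpq⟩, rfl⟩
    have hqp : 0 < q - p.2 := sub_pos.2 hpq
    rcases hx with rfl | ⟨p', ⟨hp', hqp'⟩, rfl⟩
    · exact div_nonneg (sub_nonneg.2 (hv p hp hpq.le)) hqp.le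
    · have hpq' : 0 < p'.2 - q := sub_pos.2 hqp'
      have hd : 0 < p'.2 - p.2 := by linarith
      have hmem := hS hp hp' (a := (p'.2 - q) / (p'.2 - p.2)) (b := (q - p.2) / (p'.2 - p.2))
        (by positivity) (by positivity) (by field_simp; ring)
      have hle := hv _ hmem (le_of_eq (by
        simp only [Prod.snd_add, Prod.smul_snd, smul_eq_mul]
        field_simp
        ring))
      simp only [Prod.fst_add, Prod.smul_fst, smul_eq_mul] at hle
      rw [div_mul_eq_mul_div, div_mul_eq_mul_div, ← add_div, div_le_iff₀ hd] at hle
      rw [div_le_div_iff₀ hpq' hqp]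
      linarith
  refine ⟨l, hl_right (mem_insert _ _), fun p hp => ?_⟩
  rcases lt_trichotomy p.2 q with h | h | h
  · have := hl_left ⟨p, ⟨hp, h⟩, rfl⟩
    rw [le_div_iff₀ (sub_pos.2 h)] at this
    linarith
  · rw [h]
    linarith [hv p hp h.le]
  · have := hl_right (mem_insert_of_mem _ ⟨p, ⟨hp, h⟩, rfl⟩)
    rw [div_le_iff₀ (sub_pos.2 h)] at this
    linarith

/-- A `c`-approximation at the level of Lagrangian relaxations transfers to a
`c`-approximation of the ex-ante constrained optimum at every interior
allocation cap. -/
theorem lagrangian_approx_transfers_to_constrained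
    (Sf Sg : Set (ℝ × ℝ))
    (hconvf : Convex ℝ Sf) (h0f : (0, 0) ∈ Sf)
    (haf : ∀ p ∈ Sf, p.2 ∈ Icc (0 : ℝ) 1)
    (Bf : ℝ) (hBf : ∀ p ∈ Sf, p.1 ≤ Bf)
    (hconvg : Convex ℝ Sg) (h0g : (0, 0) ∈ Sg)
    (hag : ∀ p ∈ Sg, p.2 ∈ Icc (0 : ℝ) 1)
    (Bg : ℝ) (hBg : ∀ p ∈ Sg, p.1 ≤ Bg)
    (Rf Rg : ℝ → ℝ)
    (hRf : ∀ q, Rf q = sSup {r : ℝ | ∃ a : ℝ, (r, a) ∈ Sf ∧ a ≤ q})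
    (hRg : ∀ q, Rg q = sSup {r : ℝ | ∃ a : ℝ, (r, a) ∈ Sg ∧ a ≤ q})
    (Pif Pig : ℝ → ℝ)
    (hPif : ∀ l, Pif l = sSup {x : ℝ | ∃ r a : ℝ, (r, a) ∈ Sf ∧ x = r - l * a})
    (hPig : ∀ l, Pig l = sSup {x : ℝ | ∃ r a : ℝ, (r, a) ∈ Sg ∧ x = r - l * a})
    (c : ℝ) (hc : 1 ≤ c)
    (happrox : ∀ l : ℝ, 0 ≤ l → Pif l ≤ c * Pig l) :
    ∀ q ∈ Ioo (0 : ℝ) 1, Rf q ≤ c * Rg q := by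
  rintro q ⟨hq, -⟩
  obtain ⟨l, hl, hsupp⟩ := exists_nonneg_supporting_slope hconvg (q := q) (v := Rg q)
    (fun p hp hpq => by
      rw [hRg]
      exact le_csSup ⟨Bg, by rintro r ⟨a, ha, -⟩; exact hBg _ ha⟩ ⟨p.2, hp, hpq⟩)
    ⟨_, h0g, hq⟩
  have hPig_le : Pig l ≤ Rg q - l * q := by
    rw [hPig]
    refine csSup_le ⟨_, 0, 0, h0g, rfl⟩ ?_
    rintro _ ⟨r, a, ha, rfl⟩
    exact hsupp _ ha
  have hRf_le : Rf q ≤ Pif l + l * q := by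
    rw [hRf]
    refine csSup_le ⟨0, 0, h0f, hq.le⟩ ?_
    rintro r ⟨a, ha, haq⟩
    have hbdd : BddAbove {x : ℝ | ∃ r a : ℝ, (r, a) ∈ Sf ∧ x = r - l * a} := by
      refine ⟨Bf, ?_⟩
      rintro _ ⟨r, a, ha, rfl⟩
      linarith [hBf _ ha, mul_nonneg hl (haf _ ha).1]
    have hle : r - l * a ≤ Pif l := by
      rw [hPif]
      exact le_csSup hbdd ⟨r, a, ha, rfl⟩
    linarith [mul_le_mul_of_nonneg_left haq hl]
  calc Rf q ≤ c * Pig l + l * q := hRf_le.trans (by gcongr; exact happrox l hl)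
    _ ≤ c * (Rg q - l * q) + l * q := by gcongr
    _ ≤ c * Rg q := by linarith [le_mul_of_one_le_left (mul_nonneg hl hq.le) hc]
end

section
/- Let S and T be finite sets, s₀ ∈ S, and α : S → ℝ with 0 < α(s) ≤ α(s₀) for all s ∈ S. Let χ : S → T → ℝ satisfy 0 ≤ χ(s,t) for all s,t and Σ_{s∈S} χ(s,t) ≤ 1 for all t ∈ T. Define χ'(t) = Σ_{s∈S} (α(s)/α(s₀))·χ(s,t). Then (i) 0 ≤ χ'(t) ≤ 1 for every t ∈ T, and (ii) for every γ ∈ ℝ and all p, β, v : T → ℝ, Σ_{t∈T} Σ_{s∈S} p(t)·α(s)·β(t)·γ·v(t)·χ(s,t) = Σ_{t∈T} p(t)·α(s₀)·β(t)·γ·v(t)·χ'(t); i.e., the slot-collapsed lottery is feasible and yields the same expected utility for every valuation vector. -/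
open Finset

/-- Slot-collapsing a lottery onto the highest-effect slot `s₀`, rescaling by
the ratio of slot effects, is feasible and preserves the advertiser's expected
utility for every valuation vector. -/
theorem slot_collapse_feasible_and_utility_preserving
    {S T : Type*} [Fintype S] [Fintype T]
    (s₀ : S) (α : S → ℝ) (hαpos : ∀ s, 0 < α s) (hαtop : ∀ s, α s ≤ α s₀)
    (χ : S → T → ℝ) (hχ0 : ∀ s t, 0 ≤ χ s t)
    (hχ1 : ∀ t, ∑ s : S, χ s t ≤ 1)
    (χ' : T → ℝ) (hχ' : ∀ t, χ' t = ∑ s : S, (α s / α s₀) * χ s t) :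
    (∀ t, 0 ≤ χ' t ∧ χ' t ≤ 1) ∧
      (∀ (γ : ℝ) (p β v : T → ℝ),
        ∑ t : T, ∑ s : S, p t * α s * β t * γ * v t * χ s t
          = ∑ t : T, p t * α s₀ * β t * γ * v t * χ' t) := by
  refine ⟨fun t => ?_, fun γ p β v => ?_⟩
  · rw [hχ' t]
    refine ⟨Finset.sum_nonneg fun s _ =>
      mul_nonneg (div_pos (hαpos s) (hαpos s₀)).le (hχ0 s t), ?_⟩
    refine (Finset.sum_le_sum fun s _ => ?_).trans (hχ1 t)
    exact mul_le_of_le_one_left (hχ0 s t) ((div_le_one (hαpos s₀)).2 (hαtop s))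
  · refine Finset.sum_congr rfl fun t _ => ?_
    rw [hχ' t, Finset.mul_sum]
    refine Finset.sum_congr rfl fun s _ => ?_
    have hα₀ := (hαpos s₀).ne'
    field_simp
end

section
/- Let n, k be natural numbers, let α : Fin n → ℝ be antitone with α(i) ≥ 0 for all i (slot effects sorted in decreasing order), and let m : Fin k → ℝ be antitone (advertisers' marginal revenues sorted in decreasing order). Then for every subset s ⊆ Fin n and every injective function f from s to Fin k, Σ_{i∈s} α(i)·m(f(i)) ≤ Σ_{j=0}^{min(n,k)−1} α(j)·max(m(j), 0); i.e., the greedy assignment that matches slots in decreasing order of slot effect to advertisers in decreasing order of marginal revenue, allocating only advertisers with positive marginal revenue, maximizes the total sum of marginal revenues over all feasible (injective) slot-to-advertiser assignments. -/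
open Finset

/-- **Rearrangement inequality for partial injections.** For nonnegative monovarying families,
pairing along an injective partial map never beats the diagonal pairing. -/
theorem Monovary.sum_mul_comp_le_sum_mul_of_injOn {ι : Type*} [Fintype ι] [DecidableEq ι]
    {a b : ι → ℝ} (h : Monovary a b) (ha : 0 ≤ a) (hb : 0 ≤ b) {s : Finset ι} {f : ι → ι}
    (hf : Set.InjOn f s) : ∑ i ∈ s, a i * b (f i) ≤ ∑ i, a i * b i := by
  obtain ⟨g, hg⟩ := Finset.exists_equiv_extend_of_card_eq (t := univ) (Finset.card_univ).symm
    (subset_univ (s.image f)) hf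
  let σ : Equiv.Perm ι := g.trans (Equiv.subtypeUnivEquiv mem_univ)
  calc ∑ i ∈ s, a i * b (f i) = ∑ i ∈ s, a i * b (σ i) :=
        sum_congr rfl fun i hi ↦ by rw [← hg i hi]; rfl
    _ ≤ ∑ i, a i * b (σ i) :=
        sum_le_sum_of_subset_of_nonneg (subset_univ s) fun i _ _ ↦ mul_nonneg (ha i) (hb _)
    _ ≤ ∑ i, a i * b i := h.sum_mul_comp_perm_le_sum_mul

/-- Extension by zero of the positive part of a finite real sequence. -/
noncomputable def Fin.extendPosPart {n : ℕ} (u : Fin n → ℝ) (j : ℕ) : ℝ :=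
  if h : j < n then max (u ⟨j, h⟩) 0 else 0

theorem Fin.extendPosPart_val {n : ℕ} (u : Fin n → ℝ) (i : Fin n) :
    extendPosPart u i = max (u i) 0 := by
  simp [extendPosPart]

theorem Fin.extendPosPart_of_le {n j : ℕ} (u : Fin n → ℝ) (h : n ≤ j) :
    extendPosPart u j = 0 := by
  simp [extendPosPart, h.not_gt]

theorem Fin.extendPosPart_nonneg {n : ℕ} (u : Fin n → ℝ) (j : ℕ) : 0 ≤ extendPosPart u j := by
  unfold extendPosPart
  split_ifs <;> simp

theorem Fin.antitone_extendPosPart {n : ℕ} {u : Fin n → ℝ} (hu : Antitone u) :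
    Antitone (extendPosPart u) := by
  intro i j hij
  by_cases hj : j < n
  · have hi : i < n := hij.trans_lt hj
    simpa only [extendPosPart, hi, hj, dif_pos] using
      max_le_max_right 0 (hu (Fin.mk_le_mk.2 hij))
  · rw [extendPosPart_of_le u (not_lt.1 hj)]
    exact extendPosPart_nonneg u i

/-- Greedy assignment optimality: with slot effects `α` sorted in decreasing
order and marginal revenues `m` sorted in decreasing order, every feasible
(injective) assignment of slots to advertisers yields total marginal revenue at
most that of the greedy assignment, which matches the `j`-th slot with the
`j`-th advertiser and allocates only advertisers with positive marginal
revenue. -/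
theorem greedy_assignment_maximizes_marginal_revenue
    (n k : ℕ) (α : Fin n → ℝ) (hα : Antitone α) (hα0 : ∀ i, 0 ≤ α i)
    (m : Fin k → ℝ) (hm : Antitone m) :
    ∀ (s : Finset (Fin n)) (f : Fin n → Fin k), Set.InjOn f ↑s →
      ∑ i ∈ s, α i * m (f i)
        ≤ ∑ j : Fin (min n k),
            α (Fin.castLE (Nat.min_le_left n k) j)
              * max (m (Fin.castLE (Nat.min_le_right n k) j)) 0 := by
  intro s f hf
  let a : Fin (max n k) → ℝ := fun i ↦ Fin.extendPosPart α i
  let b : Fin (max n k) → ℝ := fun i ↦ Fin.extendPosPart m i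
  let p : Fin n ↪ Fin (max n k) := (Fin.castLEEmb (Nat.le_max_left n k))
  let q : Fin n → Fin (max n k) := fun i ↦ Fin.castLE (Nat.le_max_right n k) (f i)
  have hpq (i : Fin n) : Function.extend p q id (p i) = q i := p.injective.extend_apply q id i
  have hinj : Set.InjOn (Function.extend p q id) (s.map p) := by
    intro x hx y hy hxy
    obtain ⟨i, hi, rfl⟩ := mem_map.1 (mem_coe.1 hx)
    obtain ⟨j, hj, rfl⟩ := mem_map.1 (mem_coe.1 hy)
    rw [hpq, hpq] at hxy
    rw [hf hi hj (Fin.castLE_injective _ hxy)]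
  have hmono : Monovary a b := Antitone.monovary
    (fun _ _ h ↦ Fin.antitone_extendPosPart hα h) (fun _ _ h ↦ Fin.antitone_extendPosPart hm h)
  calc ∑ i ∈ s, α i * m (f i)
      ≤ ∑ i ∈ s, a (p i) * b (q i) := by
        refine sum_le_sum fun i _ ↦ ?_
        have hai : a (p i) = α i := (Fin.extendPosPart_val α i).trans (max_eq_left (hα0 i))
        have hbi : b (q i) = max (m (f i)) 0 := Fin.extendPosPart_val m (f i)
        rw [hai, hbi]
        exact mul_le_mul_of_nonneg_left (le_max_left _ _) (hα0 i)
    _ = ∑ x ∈ s.map p, a x * b (Function.extend p q id x) := by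
        simp only [sum_map, hpq]
    _ ≤ ∑ x, a x * b x := hmono.sum_mul_comp_le_sum_mul_of_injOn
        (fun i ↦ Fin.extendPosPart_nonneg α i) (fun i ↦ Fin.extendPosPart_nonneg m i) hinj
    _ = ∑ j ∈ range (max n k), Fin.extendPosPart α j * Fin.extendPosPart m j :=
        Fin.sum_univ_eq_sum_range (fun j ↦ Fin.extendPosPart α j * Fin.extendPosPart m j) _
    _ = ∑ j ∈ range (min n k), Fin.extendPosPart α j * Fin.extendPosPart m j := by
        refine (sum_subset (range_mono min_le_max) fun j _ hj ↦ ?_).symm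
        rw [mem_range, not_lt] at hj
        rcases min_le_iff.1 hj with h | h <;> simp [Fin.extendPosPart_of_le _ h]
    _ = ∑ j : Fin (min n k), Fin.extendPosPart α j * Fin.extendPosPart m j :=
        (Fin.sum_univ_eq_sum_range _ _).symm
    _ = _ := by
        refine sum_congr rfl fun j _ ↦ ?_
        have hαj := Fin.extendPosPart_val α (Fin.castLE (Nat.min_le_left n k) j)
        have hmj := Fin.extendPosPart_val m (Fin.castLE (Nat.min_le_right n k) j)
        rw [max_eq_left (hα0 _)] at hαj
        rw [← hαj, ← hmj]
        rfl
end
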